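/- A binary network N is tree-based if and only if N has a cherry decomposition. -/

import Mathlib

open scoped Classical

noncomputable section

namespace PhyloNet

/-- A directed multigraph on vertex set `ℕ`, given by its multiset of arcs.
Phylogenetic networks are the simple such graphs satisfying `IsNetwork`;
bulged versions are genuinely multigraphs. -/
abbrev Graph := Multiset (ℕ × ℕ)

/-- The vertices of a multigraph: all endpoints of arcs. -/
def verts (M : Graph) : Finset ℕ :=
  M.toFinset.image Prod.fst ∪ M.toFinset.image Prod.snd

/-- Indegree of a vertex (counting parallel arcs with multiplicity). -/
def indeg (M : Graph) (v : ℕ) : ℕ := Multiset.card (M.filter (fun e => e.2 = v))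

/-- Outdegree of a vertex (counting parallel arcs with multiplicity). -/
def outdeg (M : Graph) (v : ℕ) : ℕ := Multiset.card (M.filter (fun e => e.1 = v))

def adj (M : Graph) (u v : ℕ) : Prop := (u, v) ∈ M

/-- A multigraph is acyclic if no vertex reaches itself by a nonempty directed walk. -/
def Acyclic (M : Graph) : Prop := ∀ v : ℕ, ¬ Relation.TransGen (adj M) v v

/-- No parallel arcs. -/
def Simple (M : Graph) : Prop := ∀ e : ℕ × ℕ, M.count e ≤ 1

/-- The root: the unique vertex of indegree 0 and outdegree 1. -/
def IsRoot (M : Graph) (v : ℕ) : Prop := v ∈ verts M ∧ indeg M v = 0 ∧ outdeg M v = 1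

/-- A leaf: a vertex of indegree 1 and outdegree 0. -/
def IsLeaf (M : Graph) (v : ℕ) : Prop := v ∈ verts M ∧ indeg M v = 1 ∧ outdeg M v = 0

/-- A tree vertex: indegree 1 and outdegree at least 2. -/
def IsTreeVertex (M : Graph) (v : ℕ) : Prop := v ∈ verts M ∧ indeg M v = 1 ∧ 2 ≤ outdeg M v

/-- A reticulation: indegree at least 2 and outdegree 1. -/
def IsRetic (M : Graph) (v : ℕ) : Prop := v ∈ verts M ∧ 2 ≤ indeg M v ∧ outdeg M v = 1

/-- A (phylogenetic) network: a simple DAG with a unique root (indegree 0, outdegree 1),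
in which every other vertex is a leaf (indegree 1, outdegree 0), a tree vertex
(indegree 1, outdegree ≥ 2) or a reticulation (indegree ≥ 2, outdegree 1).
The leaves are regarded as labelled by themselves (the label set is the leaf set). -/
def IsNetwork (M : Graph) : Prop :=
  Simple M ∧ Acyclic M ∧ (∃! v, IsRoot M v) ∧
    ∀ v ∈ verts M, IsRoot M v ∨ IsLeaf M v ∨ IsTreeVertex M v ∨ IsRetic M v

/-- The set of leaves of a multigraph. -/
def leaves (M : Graph) : Finset ℕ :=
  (verts M).filter (fun v => indeg M v = 1 ∧ outdeg M v = 0)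

/-- A network is a tree when it has no reticulations. -/
def IsTree (M : Graph) : Prop := IsNetwork M ∧ ∀ v : ℕ, ¬ IsRetic M v

/-- Binary: all vertices have total degree at most 3. -/
def IsBinary (M : Graph) : Prop := ∀ v ∈ verts M, indeg M v + outdeg M v ≤ 3

/-- Semi-binary: all tree vertices have total degree at most 3. -/
def IsSemiBinary (M : Graph) : Prop :=
  ∀ v : ℕ, IsTreeVertex M v → indeg M v + outdeg M v ≤ 3

/-- The reticulation number: total number of incoming arcs of reticulations minus
the number of reticulations. -/
def reticNumber (M : Graph) : ℕ :=
  ∑ v ∈ (verts M).filter (fun v => 2 ≤ indeg M v), (indeg M v - 1)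

/-- The bulged version `B(N)`: replace the outgoing edge of each reticulation of
indegree `k` by `k-1` parallel copies. -/
def bulged (M : Graph) : Graph :=
  M.bind (fun e =>
    Multiset.replicate
      (if 2 ≤ indeg M e.1 ∧ outdeg M e.1 = 1 then indeg M e.1 - 1 else 1) e)

/-- A cherry shape (on distinct vertices `x,y,p` with edges `px, py`) or a
reticulated cherry shape (on distinct vertices `x,y,p_x,p_y` with edges
`p_x x, p_y p_x, p_y y`, `p_x` a reticulation). -/
inductive Shape : Type where
  | cherry (x y p : ℕ) : Shape
  | retic (x y px py : ℕ) : Shape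
deriving DecidableEq

namespace Shape

/-- The edges of a shape. -/
def edges : Shape → Finset (ℕ × ℕ)
  | cherry x y p => {(p, x), (p, y)}
  | retic x y px py => {(px, x), (py, px), (py, y)}

/-- The endpoints of a shape. -/
def endpoints : Shape → Finset ℕ
  | cherry x y _ => {x, y}
  | retic x y _ _ => {x, y}

/-- The internal vertices of a shape. -/
def internals : Shape → Finset ℕ
  | cherry _ _ p => {p}
  | retic _ _ px py => {px, py}

/-- The middle edge of a reticulated cherry shape. -/
def middleEdge : Shape → Option (ℕ × ℕ)
  | cherry _ _ _ => none
  | retic _ _ px py => some (py, px)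

def isCherry : Shape → Bool
  | cherry _ _ _ => true
  | retic _ _ _ _ => false

/-- Validity of a shape as a subgraph of the multigraph `M`: the vertices are
distinct, the edges are present, and the internal reticulation of a reticulated
cherry shape is a reticulation of `M` (indegree ≥ 2 and outdegree ≥ 1). -/
def valid (M : Graph) : Shape → Prop
  | cherry x y p => x ≠ y ∧ x ≠ p ∧ y ≠ p ∧ (p, x) ∈ M ∧ (p, y) ∈ M
  | retic x y px py =>
      x ≠ y ∧ x ≠ px ∧ x ≠ py ∧ y ≠ px ∧ y ≠ py ∧ px ≠ py ∧
      (px, x) ∈ M ∧ (py, px) ∈ M ∧ (py, y) ∈ M ∧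
      2 ≤ indeg M px ∧ 1 ≤ outdeg M px

end Shape

/-- The number of shapes of `P` covering the arc `e`. -/
def covers (P : Finset Shape) (e : ℕ × ℕ) : ℕ :=
  (P.filter (fun A => e ∈ A.edges)).card

/-- A cherry cover of the multigraph `M` with root `r`: a set of valid shapes such
that every arc except the root arc is covered at least once, every outgoing arc of
a reticulation is covered exactly once (so, counted over parallel copies, exactly
as often as its multiplicity), and every arc covered as the middle edge of a
reticulated cherry shape is covered exactly once. -/
def IsCherryCover (M : Graph) (r : ℕ) (P : Finset Shape) : Prop :=
  (∀ A ∈ P, A.valid M) ∧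
  (∀ e ∈ M, e.1 ≠ r → 1 ≤ covers P e) ∧
  (∀ e ∈ M, (2 ≤ indeg M e.1 ∧ 1 ≤ outdeg M e.1) → covers P e = M.count e) ∧
  (∀ e : ℕ × ℕ, (∃ A ∈ P, A.middleEdge = some e) → covers P e = 1)

/-- A cherry decomposition of `M` with root `r`: a set of valid shapes covering
each arc except the root arc exactly once (over parallel copies, exactly as often
as its multiplicity). -/
def IsCherryDecomp (M : Graph) (r : ℕ) (P : Finset Shape) : Prop :=
  (∀ A ∈ P, A.valid M) ∧
  (∀ e ∈ M, e.1 ≠ r → covers P e = M.count e)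

/-- `A` is directly above `B` when an internal vertex of `B` is an endpoint of `A`. -/
def DirectlyAbove (A B : Shape) : Prop := ∃ v ∈ B.internals, v ∈ A.endpoints

/-- `A` is above `B` (within `P`) when some nonempty chain of shapes of `P`, each
directly above the next, leads from `A` to `B`. -/
def Above (P : Finset Shape) : Shape → Shape → Prop :=
  Relation.TransGen (fun A B => A ∈ P ∧ B ∈ P ∧ DirectlyAbove A B)

/-- A cherry cover is acyclic when no shape is above itself. -/
def AcyclicCover (P : Finset Shape) : Prop := ∀ A : Shape, ¬ Above P A A

/-- A lowest shape of `P`: one that is above no other shape of `P`. -/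
def IsLowest (P : Finset Shape) (A : Shape) : Prop :=
  A ∈ P ∧ ∀ B ∈ P, B ≠ A → ¬ Above P A B

/-- `E` is a spanning (directed) tree of `M` rooted at `r`: a subset of the arcs,
on all vertices of `M`, acyclic, in which `r` has indegree 0 and every other
vertex indegree exactly 1. -/
def IsSpanningArborescence (M : Graph) (r : ℕ) (E : Graph) : Prop :=
  E ≤ M ∧ verts E = verts M ∧ Acyclic E ∧ indeg E r = 0 ∧
    ∀ v ∈ verts E, v ≠ r → indeg E v = 1

/-- `M` has a spanning tree whose leaves are (bijectively labelled by) `L`. -/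
def HasSpanningTreeWithLeaves (M : Graph) (L : Finset ℕ) : Prop :=
  ∃ r E, IsRoot M r ∧ IsSpanningArborescence M r E ∧
    ∀ v ∈ verts E, (outdeg E v = 0 ↔ v ∈ L)

/-- A network is tree-based when it has a base tree, i.e. a spanning tree whose
leaves are exactly the (labelled) leaves of the network. -/
def IsTreeBased (M : Graph) : Prop := HasSpanningTreeWithLeaves M (leaves M)

/-- Rename the vertex `a` to `b` in an arc. -/
def rn (a b : ℕ) (e : ℕ × ℕ) : ℕ × ℕ :=
  (if e.1 = a then b else e.1, if e.2 = a then b else e.2)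

/-- The parent of a vertex (an arbitrary in-neighbour; unique for leaves). -/
def parent (M : Graph) (v : ℕ) : ℕ :=
  if h : ∃ p, (p, v) ∈ M then h.choose else 0

/-- `(x,y)` is a cherry: two distinct leaves with a common parent. -/
def IsCherryPair (M : Graph) (x y : ℕ) : Prop :=
  x ≠ y ∧ IsLeaf M x ∧ IsLeaf M y ∧ ∃ p, (p, x) ∈ M ∧ (p, y) ∈ M

/-- `(x,y)` is a reticulated cherry: leaves `x, y` such that the parent of `x` is a
reticulation that is a child of the parent of `y`. -/
def IsReticCherryPair (M : Graph) (x y : ℕ) : Prop :=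
  x ≠ y ∧ IsLeaf M x ∧ IsLeaf M y ∧
    ∃ px py, IsRetic M px ∧ (px, x) ∈ M ∧ (py, px) ∈ M ∧ (py, y) ∈ M

/-- A reducible pair: a cherry or a reticulated cherry. -/
def ReduciblePair (M : Graph) (x y : ℕ) : Prop :=
  IsCherryPair M x y ∨ IsReticCherryPair M x y

/-- Reducing the ordered pair `(x,y)` in the network `M`: delete the edges of the
corresponding cherry shape or reticulated cherry shape, delete isolated vertices,
label unlabelled outdegree-0 vertices by the label of one of their children
(formally: rename them to that child), and keep the leaf `y` below its parent when
that parent is a multifurcation.  If `(x,y)` is not reducible, do nothing. -/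
def reducePair (M : Graph) (xy : ℕ × ℕ) : Graph :=
  let x := xy.1
  let y := xy.2
  if IsCherryPair M x y then
    let p := parent M y
    if outdeg M p = 2 then ((M.erase (p, x)).erase (p, y)).map (rn p y)
    else M.erase (p, x)
  else if IsReticCherryPair M x y then
    let px := parent M x
    let py := parent M y
    let M₁ := M.erase (py, px)
    let M₂ := if indeg M px = 2 then (M₁.erase (px, x)).map (rn px x) else M₁
    if outdeg M py = 2 then (M₂.erase (py, y)).map (rn py y) else M₂
  else M

/-- Successively reduce the ordered pairs of a sequence. -/
def reduceSeq (M : Graph) : List (ℕ × ℕ) → Graph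
  | [] => M
  | e :: S => reduceSeq (reducePair M e) S

/-- Orchard: some sequence of ordered pairs reduces the network to a network on a
single leaf. -/
def IsOrchard (M : Graph) : Prop :=
  ∃ S : List (ℕ × ℕ),
    IsNetwork (reduceSeq M S) ∧ (leaves (reduceSeq M S)).card = 1

/-- One edge contraction: delete an arc and identify its endpoints. -/
def ContractStep (M M' : Graph) : Prop :=
  ∃ e ∈ M, M' = (M.erase e).map (rn e.1 e.2)

/-- `M` can be turned into `M'` by (repeatedly) contracting edges. -/
def ContractsTo : Graph → Graph → Prop := Relation.ReflTransGen ContractStep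

end PhyloNet

namespace PhyloNet

lemma mem_verts (M : Graph) (v : ℕ) :
    v ∈ verts M ↔ (∃ u, (u, v) ∈ M) ∨ (∃ w, (v, w) ∈ M) := by
  simp only [verts, Finset.mem_union, Finset.mem_image, Multiset.mem_toFinset, Prod.exists]
  constructor
  · rintro (⟨a, b, h, rfl⟩ | ⟨a, b, h, rfl⟩)
    · exact Or.inr ⟨b, h⟩
    · exact Or.inl ⟨a, h⟩
  · rintro (⟨u, h⟩ | ⟨w, h⟩)
    · exact Or.inr ⟨u, v, h, rfl⟩
    · exact Or.inl ⟨v, w, h, rfl⟩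

def ins (M : Graph) (v : ℕ) : Finset ℕ := (M.filter (fun e => e.2 = v)).toFinset.image Prod.fst
def outs (M : Graph) (v : ℕ) : Finset ℕ := (M.filter (fun e => e.1 = v)).toFinset.image Prod.snd

lemma mem_ins (M : Graph) (v u : ℕ) : u ∈ ins M v ↔ (u, v) ∈ M := by
  simp [ins]

lemma mem_outs (M : Graph) (v u : ℕ) : u ∈ outs M v ↔ (v, u) ∈ M := by
  simp [outs]

lemma card_ins (M : Graph) (hM : M.Nodup) (v : ℕ) : (ins M v).card = indeg M v := by
  unfold ins indeg
  rw [Finset.card_image_of_injOn, Multiset.toFinset_card_of_nodup (hM.filter _)]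
  rintro ⟨a, b⟩ h ⟨c, d⟩ h' hh
  simp at h h' hh
  grind

lemma card_outs (M : Graph) (hM : M.Nodup) (v : ℕ) : (outs M v).card = outdeg M v := by
  unfold outs outdeg
  rw [Finset.card_image_of_injOn, Multiset.toFinset_card_of_nodup (hM.filter _)]
  rintro ⟨a, b⟩ h ⟨c, d⟩ h' hh
  simp at h h' hh
  grind

lemma in0 {M : Graph} (hM : M.Nodup) (v : ℕ) : indeg M v = 0 ↔ ∀ u, (u, v) ∉ M := by
  rw [← card_ins M hM, Finset.card_eq_zero, Finset.eq_empty_iff_forall_notMem]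
  simp [mem_ins]

lemma out0 {M : Graph} (hM : M.Nodup) (v : ℕ) : outdeg M v = 0 ↔ ∀ u, (v, u) ∉ M := by
  rw [← card_outs M hM, Finset.card_eq_zero, Finset.eq_empty_iff_forall_notMem]
  simp [mem_outs]

lemma in1 {M : Graph} (hM : M.Nodup) (v : ℕ) :
    indeg M v = 1 ↔ ∃ a, ∀ u, (u, v) ∈ M ↔ u = a := by
  rw [← card_ins M hM, Finset.card_eq_one]
  simp [Finset.ext_iff, mem_ins]

lemma out1 {M : Graph} (hM : M.Nodup) (v : ℕ) :
    outdeg M v = 1 ↔ ∃ a, ∀ u, (v, u) ∈ M ↔ u = a := by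
  rw [← card_outs M hM, Finset.card_eq_one]
  simp [Finset.ext_iff, mem_outs]

lemma in2 {M : Graph} (hM : M.Nodup) (v : ℕ) :
    indeg M v = 2 ↔ ∃ a b, a ≠ b ∧ ∀ u, (u, v) ∈ M ↔ u = a ∨ u = b := by
  rw [← card_ins M hM, Finset.card_eq_two]
  simp [Finset.ext_iff, mem_ins]

lemma out2 {M : Graph} (hM : M.Nodup) (v : ℕ) :
    outdeg M v = 2 ↔ ∃ a b, a ≠ b ∧ ∀ u, (v, u) ∈ M ↔ u = a ∨ u = b := by
  rw [← card_outs M hM, Finset.card_eq_two]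
  simp [Finset.ext_iff, mem_outs]

def TV (M : Graph) (v : ℕ) : Prop :=
  (∃ p, ∀ u, (u, v) ∈ M ↔ u = p) ∧ ∃ a b, a ≠ b ∧ ∀ u, (v, u) ∈ M ↔ u = a ∨ u = b
def RV (M : Graph) (v : ℕ) : Prop :=
  (∃ a b, a ≠ b ∧ ∀ u, (u, v) ∈ M ↔ u = a ∨ u = b) ∧ ∃ p, ∀ u, (v, u) ∈ M ↔ u = p
def LV (M : Graph) (v : ℕ) : Prop :=
  (∃ p, ∀ u, (u, v) ∈ M ↔ u = p) ∧ ∀ u, (v, u) ∉ M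

lemma covers_one (P : Finset Shape) (e : ℕ × ℕ) :
    covers P e = 1 ↔ ∃ A ∈ P, e ∈ A.edges ∧ ∀ B ∈ P, e ∈ B.edges → B = A := by
  unfold covers
  rw [Finset.card_eq_one]
  constructor
  · rintro ⟨A, hA⟩
    have h : ∀ B, B ∈ P ∧ e ∈ B.edges ↔ B = A := by
      intro B
      simpa using Finset.ext_iff.1 hA B
    exact ⟨A, ((h A).2 rfl).1, ((h A).2 rfl).2, fun B h1 h2 => (h B).1 ⟨h1, h2⟩⟩
  · rintro ⟨A, h1, h2, h3⟩
    refine ⟨A, ?_⟩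
    ext B
    simp only [Finset.mem_filter, Finset.mem_singleton]
    exact ⟨fun h => h3 B h.1 h.2, fun h => h ▸ ⟨h1, h2⟩⟩

lemma cls {N : Graph} {r : ℕ} (hN : IsNetwork N) (hb : IsBinary N) (hr : IsRoot N r)
    (hd : N.Nodup) (v : ℕ) (hv : v ∈ verts N) : v = r ∨ LV N v ∨ TV N v ∨ RV N v := by
  obtain ⟨-, -, ⟨s, hs, hu⟩, hc⟩ := hN
  have hbv := hb v hv
  rcases hc v hv with h | h | h | h
  · left
    rw [hu v h, hu r hr]
  · right; left
    exact ⟨(in1 hd v).1 h.2.1, (out0 hd v).1 h.2.2⟩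
  · right; right; left
    obtain ⟨_, h1, h2⟩ := h
    exact ⟨(in1 hd v).1 h1, (out2 hd v).1 (by omega)⟩
  · right; right; right
    obtain ⟨_, h1, h2⟩ := h
    exact ⟨(in2 hd v).1 (by omega), (out1 hd v).1 h2⟩

lemma decomp_treeBased (N : Graph) (r : ℕ)
    (hN : IsNetwork N) (hb : IsBinary N) (hr : IsRoot N r) (hd : N.Nodup)
    (P : Finset Shape) (hP : IsCherryDecomp N r P) : IsTreeBased N := by
  have hcls := cls hN hb hr hd
  obtain ⟨hval, hcov⟩ := hP
  have hcov' : ∀ u w, (u, w) ∈ N → u ≠ r →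
      ∃ A ∈ P, (u, w) ∈ A.edges ∧ ∀ B ∈ P, (u, w) ∈ B.edges → B = A := by
    intro u w h hu
    have := hcov (u, w) h hu
    rw [Multiset.count_eq_one_of_mem hd h] at this
    exact (covers_one _ _).1 this
  obtain ⟨hrv, hr0, hr1⟩ := hr
  rw [in0 hd] at hr0
  rw [out1 hd] at hr1
  obtain ⟨c, hc⟩ := hr1
  set E : Graph := N.filter (fun e => ¬ ∃ x y, Shape.retic x y e.2 e.1 ∈ P) with hE
  have hEd : E.Nodup := hd.filter _
  have memE : ∀ u w, (u, w) ∈ E ↔ (u, w) ∈ N ∧ ¬ ∃ x y, Shape.retic x y w u ∈ P := by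
    intro u w
    simp [hE]
  -- facts on retic shapes
  have hsh : ∀ x y px py, Shape.retic x y px py ∈ P →
      RV N px ∧ TV N py ∧ (px, x) ∈ N ∧ (py, px) ∈ N ∧ (py, y) ∈ N ∧ y ≠ px := by
    intro x y px py h
    obtain ⟨-, -, -, h1, -, -, h2, h3, h4, h5, -⟩ := hval _ h
    refine ⟨?_, ?_, h2, h3, h4, h1⟩
    · rcases hcls px ((mem_verts _ _).2 (Or.inl ⟨_, h3⟩)) with h | h | h | h
      · exact absurd (h ▸ h3) (hr0 _)
      · have := (in1 hd px).2 h.1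
        omega
      · have := (in1 hd px).2 h.1
        omega
      · exact h
    · rcases hcls py ((mem_verts _ _).2 (Or.inr ⟨_, h3⟩)) with h | h | h | h
      · subst h
        rw [hc] at h3 h4
        exact absurd (h4.trans h3.symm) h1
      · exact absurd h3 (h.2 _)
      · exact h
      · obtain ⟨-, p, hp⟩ := h
        rw [hp] at h3 h4
        exact absurd (h4.trans h3.symm) h1
  have hnr : ∀ v, RV N v → v ≠ r := by
    rintro v ⟨⟨a, b, -, h⟩, -⟩ rfl
    exact hr0 a ((h a).2 (Or.inl rfl))
  have hnt : ∀ v, TV N v → v ≠ r := by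
    rintro v ⟨⟨a, h⟩, -⟩ rfl
    exact hr0 a ((h a).2 rfl)
  have hTR : ∀ v, TV N v → ¬ RV N v := by
    rintro v ⟨h, -⟩ ⟨h', -⟩
    have := (in1 hd v).2 h
    have := (in2 hd v).2 h'
    omega
  have hLR : ∀ v, LV N v → ¬ RV N v := by
    rintro v ⟨h, -⟩ ⟨h', -⟩
    have := (in1 hd v).2 h
    have := (in2 hd v).2 h'
    omega
  -- each reticulation has exactly one retic shape
  have hret : ∀ v, RV N v → ∃ x y p, Shape.retic x y v p ∈ P ∧
      ∀ x' y' p', Shape.retic x' y' v p' ∈ P → p' = p := by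
    intro v hv
    obtain ⟨w, hw⟩ := hv.2
    have hvw := (hw w).2 rfl
    obtain ⟨A, hA, hmem, huniq⟩ := hcov' v w hvw (hnr v hv)
    have key : ∀ x' y' p', Shape.retic x' y' v p' ∈ P → Shape.retic x' y' v p' = A := by
      intro x' y' p' h
      refine huniq _ h ?_
      have := (hw x').1 (hsh _ _ _ _ h).2.2.1
      simp [Shape.edges, this]
    cases A with
    | cherry x y p =>
      exfalso
      obtain ⟨h1, -, -, h2, h3⟩ := hval _ hA
      simp [Shape.edges] at hmem
      have : v = p := by tauto
      subst this
      rw [hw] at h2 h3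
      exact h1 (h2.trans h3.symm)
    | retic x y px py =>
      have hs := hsh _ _ _ _ hA
      have hne : v ≠ py := by
        rintro rfl
        exact hTR _ hs.2.1 hv
      simp [Shape.edges, hne] at hmem
      obtain ⟨rfl, rfl⟩ := hmem
      refine ⟨w, y, py, hA, ?_⟩
      intro x' y' p' h
      have := key _ _ _ h
      simp at this
      exact this.2.2
  have hin : ∀ v ∈ verts N, v ≠ r → indeg E v = 1 := by
    intro v hv hvr
    rw [in1 hEd]
    rcases hcls v hv with h | h | h | h
    · exact absurd h hvr
    · obtain ⟨p, hp⟩ := h.1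
      refine ⟨p, fun u => ?_⟩
      rw [memE, hp]
      refine ⟨fun h => h.1, fun h' => ⟨h', ?_⟩⟩
      rintro ⟨x, y, hxy⟩
      exact hLR _ h (hsh _ _ _ _ hxy).1
    · obtain ⟨p, hp⟩ := h.1
      refine ⟨p, fun u => ?_⟩
      rw [memE, hp]
      refine ⟨fun h => h.1, fun h' => ⟨h', ?_⟩⟩
      rintro ⟨x, y, hxy⟩
      exact hTR _ h (hsh _ _ _ _ hxy).1
    · obtain ⟨x, y, p, hp, hu⟩ := hret v h
      obtain ⟨⟨a, b, hab, hin⟩, -⟩ := h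
      have hpN := (hsh _ _ _ _ hp).2.2.2.1
      rw [hin] at hpN
      rcases hpN with rfl | rfl
      · refine ⟨b, fun u => ?_⟩
        rw [memE, hin]
        constructor
        · rintro ⟨rfl | rfl, h2⟩
          · exact absurd ⟨x, y, hp⟩ h2
          · rfl
        · rintro rfl
          refine ⟨Or.inr rfl, ?_⟩
          rintro ⟨x', y', h'⟩
          exact hab (hu _ _ _ h').symm
      · refine ⟨a, fun u => ?_⟩
        rw [memE, hin]
        constructor
        · rintro ⟨rfl | rfl, h2⟩
          · rfl
          · exact absurd ⟨x, y, hp⟩ h2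
        · rintro rfl
          refine ⟨Or.inl rfl, ?_⟩
          rintro ⟨x', y', h'⟩
          exact hab (hu _ _ _ h')
  have hrc : (r, c) ∈ E := by
    rw [memE]
    refine ⟨(hc c).2 rfl, ?_⟩
    rintro ⟨x, y, h⟩
    exact hnt _ (hsh _ _ _ _ h).2.1 rfl
  have hverts : verts E = verts N := by
    ext v
    constructor
    · rw [mem_verts, mem_verts]
      rintro (⟨u, h⟩ | ⟨u, h⟩)
      · exact Or.inl ⟨u, ((memE _ _).1 h).1⟩
      · exact Or.inr ⟨u, ((memE _ _).1 h).1⟩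
    · intro hv
      rw [mem_verts]
      by_cases h : v = r
      · subst h
        exact Or.inr ⟨c, hrc⟩
      · obtain ⟨a, ha⟩ := (in1 hEd v).1 (hin v hv h)
        exact Or.inl ⟨a, (ha a).2 rfl⟩
  refine ⟨r, E, ⟨hrv, (in0 hd r).2 hr0, (out1 hd r).2 ⟨c, hc⟩⟩,
    ⟨Multiset.filter_le _ _, hverts, ?_, ?_, ?_⟩, ?_⟩
  · intro v hv
    refine hN.2.1 v (Relation.TransGen.mono ?_ _ _ hv)
    intro a b h
    exact ((memE _ _).1 h).1
  · rw [in0 hEd]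
    intro u h
    exact hr0 u ((memE _ _).1 h).1
  · rw [hverts]
    exact hin
  · rw [hverts]
    intro v hv
    rw [out0 hEd]
    simp only [leaves, Finset.mem_filter, hv, true_and]
    rw [in1 hd, out0 hd]
    constructor
    · intro h
      rcases hcls v hv with h' | h' | h' | h'
      · subst h'
        exact absurd hrc (h c)
      · exact h'
      · exfalso
        obtain ⟨a, b, hab, hch⟩ := h'.2
        have ha := h a
        have hb := h b
        rw [memE] at ha hb
        have haN := (hch a).2 (Or.inl rfl)
        have hbN := (hch b).2 (Or.inr rfl)
        simp only [haN, hbN, true_and, not_not] at ha hb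
        obtain ⟨x, y, h1⟩ := ha
        obtain ⟨x', y', h2⟩ := hb
        obtain ⟨A, hA, -, hu⟩ := hcov' v b hbN (hnt v h')
        have e2 := hu _ h2 (by simp [Shape.edges])
        have hy : y = b := by
          have h3 := hsh _ _ _ _ h1
          have := (hch y).1 h3.2.2.2.2.1
          tauto
        have e1 := hu _ h1 (by simp [Shape.edges, hy])
        have := e1.trans e2.symm
        simp at this
        exact hab this.2.2
      · exfalso
        obtain ⟨w, hw⟩ := h'.2
        refine h w ((memE _ _).2 ⟨(hw w).2 rfl, ?_⟩)
        rintro ⟨x, y, h1⟩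
        exact hTR _ (hsh _ _ _ _ h1).2.1 h'
    · intro h u hu
      exact h.2 u ((memE _ _).1 hu).1

def Good (N E : Graph) (p : ℕ) : Shape → Prop
  | .cherry x y q => q = p ∧ (p, x) ∈ E ∧ (p, y) ∈ E ∧ ∀ w, (p, w) ∈ N → w = x ∨ w = y
  | .retic x y px py => py = p ∧ (p, px) ∉ E ∧ (p, y) ∈ E ∧ RV N px ∧
      (∀ w, (p, w) ∈ N → w = px ∨ w = y) ∧ ∀ w, (px, w) ∈ N → w = x

lemma treeBased_decomp (N : Graph) (r : ℕ)
    (hN : IsNetwork N) (hb : IsBinary N) (hr : IsRoot N r) (hd : N.Nodup)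
    (hT : IsTreeBased N) : ∃ P : Finset Shape, IsCherryDecomp N r P := by
  have hcls := cls hN hb hr hd
  obtain ⟨r', E, hr', ⟨hle, hverts, -, -, hin⟩, hout⟩ := hT
  obtain ⟨s, -, hu⟩ := hN.2.2.1
  have hrr : r' = r := by rw [hu r hr, hu r' hr']
  subst hrr
  have hEd : E.Nodup := Multiset.nodup_of_le hle hd
  have hEN : ∀ u w, (u, w) ∈ E → (u, w) ∈ N := fun u w h => Multiset.mem_of_le hle h
  have hloop : ∀ v, (v, v) ∉ N := fun v h => hN.2.1 v (Relation.TransGen.single h)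
  have h2c : ∀ u v, (u, v) ∈ N → (v, u) ∉ N := fun u v h h' =>
    hN.2.1 u (Relation.TransGen.tail (Relation.TransGen.single h) h')
  have hvl : ∀ u v, (u, v) ∈ N → u ∈ verts N := fun u v h => (mem_verts _ _).2 (Or.inr ⟨_, h⟩)
  have hvr : ∀ u v, (u, v) ∈ N → v ∈ verts N := fun u v h => (mem_verts _ _).2 (Or.inl ⟨_, h⟩)
  have hr0 := (in0 hd r').1 hr.2.1
  rw [hverts] at hin hout
  -- each nonroot vertex has a unique parent in E
  have hpar : ∀ u v, (u, v) ∈ N → ∃ a, ∀ u', (u', v) ∈ E ↔ u' = a := by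
    intro u v h
    refine (in1 hEd v).1 (hin v (hvr _ _ h) ?_)
    rintro rfl
    exact hr0 _ h
  have hchild : ∀ u v, (u, v) ∈ N → ∃ w, (u, w) ∈ E := by
    intro u v h
    by_contra hcon
    push Not at hcon
    have := (hout u (hvl _ _ h)).1 ((out0 hEd u).2 hcon)
    simp only [leaves, Finset.mem_filter] at this
    exact (out0 hd u).1 this.2.2 v h
  have hTR : ∀ v, TV N v → ¬ RV N v := by
    rintro v ⟨h, -⟩ ⟨h', -⟩
    have := (in1 hd v).2 h
    have := (in2 hd v).2 h'
    omega
  -- missing arcs end in reticulations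
  have hmiss : ∀ u v, (u, v) ∈ N → (u, v) ∉ E → RV N v := by
    intro u v h h'
    rcases hcls v (hvr _ _ h) with hv | hv | hv | hv
    · subst hv
      exact absurd h (hr0 _)
    · obtain ⟨a, ha⟩ := hpar u v h
      obtain ⟨p, hp⟩ := hv.1
      exact absurd ((ha u).2 (((hp u).1 h).trans ((hp a).1 (hEN _ _ ((ha a).2 rfl))).symm)) h'
    · obtain ⟨a, ha⟩ := hpar u v h
      obtain ⟨p, hp⟩ := hv.1
      exact absurd ((ha u).2 (((hp u).1 h).trans ((hp a).1 (hEN _ _ ((ha a).2 rfl))).symm)) h'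
    · exact hv
  -- out-arcs of reticulations are in E
  have hRE : ∀ v w, RV N v → (v, w) ∈ N → (v, w) ∈ E := by
    rintro v w ⟨-, x, hx⟩ h
    obtain ⟨w', hw'⟩ := hchild v w h
    rw [(hx w).1 h, ← (hx w').1 (hEN _ _ hw')]
    exact hw'
  -- missing arcs start in tree vertices
  have hmissT : ∀ u v, (u, v) ∈ N → (u, v) ∉ E → TV N u := by
    intro u v h h'
    rcases hcls u (hvl _ _ h) with hv | hv | hv | hv
    · subst hv
      obtain ⟨c, hc⟩ := (out1 hd u).1 hr.2.2
      obtain ⟨w', hw'⟩ := hchild u v h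
      rw [(hc v).1 h, ← (hc w').1 (hEN _ _ hw')] at h'
      exact absurd hw' h'
    · exact absurd h (hv.2 _)
    · exact hv
    · exact absurd (hRE u v hv h) h'
  have mk : ∀ p a b, a ≠ b → (∀ u, (p, u) ∈ N ↔ u = a ∨ u = b) → (p, a) ∉ E →
      ∃ A : Shape, A.valid N ∧ Good N E p A := by
    intro p a b hab hch ha
    have haN := (hch a).2 (Or.inl rfl)
    have hbN := (hch b).2 (Or.inr rfl)
    have hbE : (p, b) ∈ E := by
      obtain ⟨w, hw⟩ := hchild p a haN
      rcases (hch w).1 (hEN _ _ hw) with rfl | rfl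
      · exact absurd hw ha
      · exact hw
    have hR := hmiss p a haN ha
    obtain ⟨x, hx⟩ := hR.2
    have hxN := (hx x).2 rfl
    have hxE := hRE _ _ hR hxN
    refine ⟨.retic x b a p, ⟨?_, ?_, ?_, ?_, ?_, ?_, hxN, haN, hbN, ?_, ?_⟩,
      rfl, ha, hbE, hR, fun w => (hch w).1, fun w => (hx w).1⟩
    · rintro rfl
      obtain ⟨q, hq⟩ := hpar _ _ hxN
      have : a = p := ((hq a).1 hxE).trans ((hq p).1 hbE).symm
      subst this
      exact hloop _ haN
    · rintro rfl
      exact hloop _ hxN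
    · rintro rfl
      exact h2c _ _ hxN haN
    · exact hab.symm
    · rintro rfl
      exact hloop _ hbN
    · rintro rfl
      exact hloop _ haN
    · rw [(in2 hd a).2 hR.1]
    · rw [(out1 hd a).2 hR.2]
  have hex : ∀ p, ∃ A : Shape, TV N p → A.valid N ∧ Good N E p A := by
    intro p
    by_cases hp : TV N p
    · obtain ⟨a, b, hab, hch⟩ := hp.2
      have haN := (hch a).2 (Or.inl rfl)
      have hbN := (hch b).2 (Or.inr rfl)
      by_cases ha : (p, a) ∈ E
      · by_cases hb : (p, b) ∈ E
        · refine ⟨.cherry a b p, fun _ => ⟨⟨hab, ?_, ?_, haN, hbN⟩, rfl, ha, hb,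
            fun w => (hch w).1⟩⟩
          · rintro rfl
            exact hloop _ haN
          · rintro rfl
            exact hloop _ hbN
        · obtain ⟨A, hA⟩ := mk p b a hab.symm (fun u => by rw [hch]; tauto) hb
          exact ⟨A, fun _ => hA⟩
      · obtain ⟨A, hA⟩ := mk p a b hab hch ha
        exact ⟨A, fun _ => hA⟩
    · exact ⟨.cherry 0 0 0, fun h => absurd h hp⟩
  choose f hf using hex
  refine ⟨((verts N).filter (fun p => TV N p)).image f, ?_, ?_⟩
  · intro A hA
    simp only [Finset.mem_image, Finset.mem_filter] at hA
    obtain ⟨p, ⟨-, hp⟩, rfl⟩ := hA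
    exact (hf p hp).1
  · rintro ⟨u, w⟩ huw hur
    simp only at hur
    rw [Multiset.count_eq_one_of_mem hd huw, covers_one]
    rcases hcls u (hvl _ _ huw) with hv | hv | hv | hv
    · exact absurd hv hur
    · exact absurd huw (hv.2 _)
    · refine ⟨f u, Finset.mem_image_of_mem _ (Finset.mem_filter.2 ⟨hvl _ _ huw, hv⟩), ?_, ?_⟩
      · have := (hf u hv).2
        cases hfu : f u with
        | cherry x y q =>
          rw [hfu] at this
          obtain ⟨rfl, -, -, h⟩ := this
          have := h w huw
          simp [Shape.edges, this]
        | retic x y px py =>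
          rw [hfu] at this
          obtain ⟨rfl, -, -, -, h, -⟩ := this
          have := h w huw
          simp [Shape.edges]
          tauto
      · intro B hB hmem
        simp only [Finset.mem_image, Finset.mem_filter] at hB
        obtain ⟨p, ⟨-, hp⟩, rfl⟩ := hB
        congr 1
        have := (hf p hp).2
        cases hfp : f p with
        | cherry x y q =>
          rw [hfp] at this hmem
          obtain ⟨rfl, -, -, h⟩ := this
          simp [Shape.edges] at hmem
          tauto
        | retic x y px py =>
          rw [hfp] at this hmem
          obtain ⟨rfl, -, -, hR, h, -⟩ := this
          have : u ≠ px := by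
            rintro rfl
            exact hTR _ hv hR
          simp [Shape.edges, this] at hmem
          tauto
    · -- reticulation
      have hmissp : ∃ p, (p, u) ∈ N ∧ (p, u) ∉ E ∧ ∀ q, (q, u) ∈ N → (q, u) ∉ E → q = p := by
        obtain ⟨a, b, hab, hp⟩ := hv.1
        have haN := (hp a).2 (Or.inl rfl)
        have hbN := (hp b).2 (Or.inr rfl)
        obtain ⟨c, hc⟩ := hpar _ _ haN
        rcases (hp c).1 (hEN _ _ ((hc c).2 rfl)) with rfl | rfl
        · refine ⟨b, hbN, fun h => hab ((hc b).1 h).symm, fun q h1 h2 => ?_⟩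
          rcases (hp q).1 h1 with rfl | rfl
          · exact absurd ((hc q).2 rfl) h2
          · rfl
        · refine ⟨a, haN, fun h => hab ((hc a).1 h), fun q h1 h2 => ?_⟩
          rcases (hp q).1 h1 with rfl | rfl
          · rfl
          · exact absurd ((hc q).2 rfl) h2
      obtain ⟨p, hpN, hpE, hpu⟩ := hmissp
      have hpT := hmissT _ _ hpN hpE
      refine ⟨f p, Finset.mem_image_of_mem _ (Finset.mem_filter.2 ⟨hvl _ _ hpN, hpT⟩), ?_, ?_⟩
      · have := (hf p hpT).2
        cases hfp : f p with
        | cherry x y q =>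
          rw [hfp] at this
          obtain ⟨rfl, h1, h2, h⟩ := this
          rcases h u hpN with rfl | rfl
          · exact absurd h1 hpE
          · exact absurd h2 hpE
        | retic x y px py =>
          rw [hfp] at this
          obtain ⟨rfl, h1, h2, -, h, h'⟩ := this
          rcases h u hpN with rfl | rfl
          · have := h' w huw
            simp [Shape.edges, this]
          · exact absurd h2 hpE
      · intro B hB hmem
        simp only [Finset.mem_image, Finset.mem_filter] at hB
        obtain ⟨q, ⟨-, hq⟩, rfl⟩ := hB
        congr 1
        have huq : u ≠ q := by
          rintro rfl
          exact hTR _ hq hv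
        obtain ⟨hqv, this⟩ := hf q hq
        cases hfq : f q with
        | cherry x y q' =>
          rw [hfq] at this hmem
          obtain ⟨rfl, -, -, h⟩ := this
          simp [Shape.edges] at hmem
          tauto
        | retic x y px py =>
          rw [hfq] at this hmem hqv
          obtain ⟨rfl, h1, -, hR, h, -⟩ := this
          simp [Shape.edges, huq] at hmem
          obtain ⟨rfl, rfl⟩ := hmem
          exact hpu _ hqv.2.2.2.2.2.2.2.1 h1

/-- **Theorem (statement 1).** A binary network `N` is tree-based if and only if
`N` has a cherry decomposition. -/
theorem binary_treeBased_iff_cherryDecomp (N : Graph) (r : ℕ)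
    (hN : IsNetwork N) (hb : IsBinary N) (hr : IsRoot N r) :
    IsTreeBased N ↔ ∃ P : Finset Shape, IsCherryDecomp N r P := by
  have hd : N.Nodup := Multiset.nodup_iff_count_le_one.2 hN.1
  constructor
  · exact treeBased_decomp N r hN hb hr hd
  · rintro ⟨P, hP⟩
    exact decomp_treeBased N r hN hb hr hd P hP

end PhyloNet
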